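/- arXiv:1811.00844 — 2 statements merged into one kernel-verified Lean document; each statement's English description precedes it below -/
import Mathlib

section
/- Let ℓ ≥ 1 and suppose the edges of the complete graph K_n are coloured red and blue. Then V(K_n) can be partitioned into the vertex sets of ℓ vertex-disjoint blue paths and the vertex set of a red balanced complete (ℓ+1)-partite graph, all pairwise vertex-disjoint. -/
open Classical in
/-- One step of depth-first search, on the pair of the current stack (top first) and the set of
unvisited vertices. -/
noncomputable def dfsStep {V : Type*} (G : SimpleGraph V) :
    List V × Finset V → List V × Finset V
  | ([], U) => if h : U.Nonempty then ([h.choose], U.erase h.choose) else ([], U)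
  | (v :: l, U) =>
    if h : ∃ w ∈ U, G.Adj v w then (h.choose :: v :: l, U.erase h.choose) else (l, U)

/-- A step of depth-first search pushes an unvisited neighbour of the top of the stack, pops a
vertex without unvisited neighbours, or has nothing left to do. -/
theorem dfsStep_cases {V : Type*} [DecidableEq V] (G : SimpleGraph V) (L : List V)
    (U : Finset V) :
    (∃ v ∈ U, dfsStep G (L, U) = (v :: L, U.erase v) ∧ ∀ w ∈ L.head?, G.Adj v w) ∨
    (∃ v l, L = v :: l ∧ dfsStep G (L, U) = (l, U) ∧ ∀ w ∈ U, ¬ G.Adj v w) ∨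
    (L = [] ∧ U = ∅ ∧ dfsStep G (L, U) = ([], ∅)) := by
  rcases L with _ | ⟨v, l⟩
  · by_cases h : U.Nonempty
    · refine Or.inl ⟨h.choose, h.choose_spec, ?_, by simp⟩
      simp only [dfsStep, dif_pos h]
      congr!
    · refine Or.inr (Or.inr ⟨rfl, Finset.not_nonempty_iff_eq_empty.1 h, ?_⟩)
      simp only [dfsStep, dif_neg h]
      rw [Finset.not_nonempty_iff_eq_empty.1 h]
  · by_cases h : ∃ w ∈ U, G.Adj v w
    · refine Or.inl ⟨h.choose, h.choose_spec.1, ?_, ?_⟩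
      · simp only [dfsStep, dif_pos h]
        congr!
      · simpa using h.choose_spec.2.symm
    · refine Or.inr (Or.inl ⟨v, l, rfl, ?_, ?_⟩)
      · simp only [dfsStep, dif_neg h]
      · push Not at h
        exact h

/-- A complete run of depth-first search: `L t` is the stack (top first) and `U t` the set of
unvisited vertices at time `t`. -/
structure IsDFSRun {V : Type*} [Fintype V] [DecidableEq V] (G : SimpleGraph V)
    (L : ℕ → List V) (U : ℕ → Finset V) (T : ℕ) : Prop where
  init_stack : L 0 = []
  init_unvisited : U 0 = Finset.univ
  final_stack : L T = []
  final_unvisited : U T = ∅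
  step : ∀ t, (∃ v ∈ U t, L (t + 1) = v :: L t ∧ U (t + 1) = (U t).erase v ∧
      ∀ w ∈ (L t).head?, G.Adj v w) ∨
    (∃ v, L t = v :: L (t + 1) ∧ U (t + 1) = U t ∧ ∀ w ∈ U t, ¬ G.Adj v w) ∨
    (L (t + 1) = L t ∧ U (t + 1) = U t)

theorem exists_isDFSRun {V : Type*} [Fintype V] [DecidableEq V] (G : SimpleGraph V) :
    ∃ L U T, IsDFSRun G L U T := by
  let σ : ℕ → List V × Finset V := fun t => (dfsStep G)^[t] ([], Finset.univ)
  have hσ : ∀ t, σ (t + 1) = dfsStep G ((σ t).1, (σ t).2) := fun t =>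
    Function.iterate_succ_apply' _ _ _
  have hμ : ∀ t, 2 * (σ t).2.card + (σ t).1.length ≤ 2 * Fintype.card V - t := by
    intro t
    induction t with
    | zero => simp [σ]
    | succ t ih =>
      rw [hσ]
      rcases dfsStep_cases G (σ t).1 (σ t).2 with ⟨v, hv, h, -⟩ | ⟨v, l, hl, h, -⟩ | ⟨-, -, h⟩
      · rw [h]
        have := Finset.card_erase_add_one hv
        simp only [List.length_cons]
        omega
      · rw [h]
        rw [hl, List.length_cons] at ih
        simp only
        omega
      · rw [h]
        simp
  have hT := hμ (2 * Fintype.card V)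
  refine ⟨fun t => (σ t).1, fun t => (σ t).2, 2 * Fintype.card V, rfl, rfl, ?_, ?_, ?_⟩
  · exact List.length_eq_zero_iff.1 (by omega)
  · exact Finset.card_eq_zero.1 (by omega)
  · intro t
    simp only [hσ]
    rcases dfsStep_cases G (σ t).1 (σ t).2 with ⟨v, hv, h, h'⟩ | ⟨v, l, hl, h, h'⟩ | ⟨h1, h2, h⟩
    · exact Or.inl ⟨v, hv, by rw [h], by rw [h], h'⟩
    · exact Or.inr (Or.inl ⟨v, by rw [h, hl], by rw [h], h'⟩)
    · exact Or.inr (Or.inr ⟨by rw [h, h1], by rw [h, h2]⟩)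

namespace IsDFSRun

variable {V : Type*} [Fintype V] [DecidableEq V] {G : SimpleGraph V}
  {L : ℕ → List V} {U : ℕ → Finset V} {T : ℕ}

theorem antitone (h : IsDFSRun G L U T) : Antitone U := by
  refine antitone_nat_of_succ_le fun t => ?_
  rcases h.step t with ⟨v, -, -, hU, -⟩ | ⟨v, -, hU, -⟩ | ⟨-, hU⟩
  · rw [hU]
    exact Finset.erase_subset _ _
  · rw [hU]
  · rw [hU]

theorem notMem_unvisited (h : IsDFSRun G L U T) (t : ℕ) : ∀ v ∈ L t, v ∉ U t := by
  induction t with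
  | zero => simp [h.init_stack]
  | succ t ih =>
    rcases h.step t with ⟨v, -, hL, hU, -⟩ | ⟨v, hL, hU, -⟩ | ⟨hL, hU⟩
    · rw [hL, hU]
      grind
    · rw [hU]
      rw [hL] at ih
      grind
    · rwa [hL, hU]

theorem isChain (h : IsDFSRun G L U T) (t : ℕ) : (L t).IsChain G.Adj := by
  induction t with
  | zero => simp [h.init_stack]
  | succ t ih =>
    rcases h.step t with ⟨v, -, hL, -, hv⟩ | ⟨v, hL, -, -⟩ | ⟨hL, -⟩
    · rw [hL]
      exact List.isChain_cons.2 ⟨hv, ih⟩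
    · rw [hL] at ih
      exact ih.tail
    · rwa [hL]

theorem nodup (h : IsDFSRun G L U T) (t : ℕ) : (L t).Nodup := by
  induction t with
  | zero => simp [h.init_stack]
  | succ t ih =>
    rcases h.step t with ⟨v, hv, hL, -, -⟩ | ⟨v, hL, -, -⟩ | ⟨hL, -⟩
    · rw [hL]
      exact List.nodup_cons.2 ⟨fun hm => h.notMem_unvisited t v hm hv, ih⟩
    · rw [hL] at ih
      exact ih.of_cons
    · rwa [hL]

/-- Vertices already popped have no unvisited neighbours. -/
theorem not_adj (h : IsDFSRun G L U T) (t : ℕ) :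
    ∀ u, u ∉ U t → u ∉ L t → ∀ v ∈ U t, ¬ G.Adj u v := by
  induction t with
  | zero => simp [h.init_unvisited]
  | succ t ih =>
    rcases h.step t with ⟨v, hv, hL, hU, -⟩ | ⟨v, hL, hU, hv⟩ | ⟨hL, hU⟩
    · rw [hL, hU]
      grind
    · rw [hU]
      rw [hL] at ih
      grind
    · rwa [hL, hU]

theorem exists_append (h : IsDFSRun G L U T) (a k : ℕ) :
    ∃ p s, L (a + k) = p ++ s ∧ (∀ v ∈ p, v ∈ U a) ∧ ∀ v ∈ s, v ∈ L a := by
  induction k with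
  | zero => exact ⟨[], L a, by simp⟩
  | succ k ih =>
    obtain ⟨p, s, hps, hp, hs⟩ := ih
    rcases h.step (a + k) with ⟨v, hv, hL, -, -⟩ | ⟨v, hL, -, -⟩ | ⟨hL, -⟩
    · refine ⟨v :: p, s, by rw [← add_assoc, hL, hps, List.cons_append], ?_, hs⟩
      have := h.antitone (Nat.le_add_right a k) hv
      grind
    · rw [hL] at hps
      rcases p with _ | ⟨w, p⟩
      · refine ⟨[], L (a + (k + 1)), by simp, by simp, fun v hv => hs v ?_⟩
        rw [List.nil_append] at hps
        rw [← hps]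
        exact List.mem_cons_of_mem _ hv
      · rw [List.cons_append] at hps
        exact ⟨p, s, (List.cons.inj hps).2, fun v hv => hp v (List.mem_cons_of_mem _ hv), hs⟩
    · exact ⟨p, s, by rw [← add_assoc, hL, hps], hp, hs⟩

theorem isChain_filter (h : IsDFSRun G L U T) {a b : ℕ} (hab : a ≤ b) :
    ((L b).filter (· ∈ U a)).IsChain G.Adj := by
  obtain ⟨k, rfl⟩ := Nat.exists_eq_add_of_le hab
  obtain ⟨p, s, hps, hp, hs⟩ := h.exists_append a k
  have hc := h.isChain (a + k)
  rw [hps] at hc ⊢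
  rw [List.filter_append, List.filter_eq_self.2 (by simpa using hp),
    List.filter_eq_nil_iff.2 (by simpa using fun v hv => h.notMem_unvisited a v (hs v hv)),
    List.append_nil]
  exact hc.left_of_append

theorem step_union (h : IsDFSRun G L U T) (t : ℕ) :
    (U (t + 1) ∪ (L (t + 1)).toFinset = U t ∪ (L t).toFinset ∧ (U t \ U (t + 1)).card ≤ 1) ∨
    (U (t + 1) = U t ∧ U (t + 1) ∪ (L (t + 1)).toFinset ⊆ U t ∪ (L t).toFinset ∧
      ((U t ∪ (L t).toFinset) \ (U (t + 1) ∪ (L (t + 1)).toFinset)).card ≤ 1) := by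
  rcases h.step t with ⟨v, hv, hL, hU, -⟩ | ⟨v, hL, hU, hv⟩ | ⟨hL, hU⟩
  · refine Or.inl ⟨?_, ?_⟩
    · rw [hL, hU]
      ext w
      by_cases hw : w = v <;> simp [hw, hv]
    · rw [hU, Finset.sdiff_erase hv, Finset.sdiff_self]
      simp
  · refine Or.inr ⟨hU, ?_, ?_⟩
    · rw [hL, hU, List.toFinset_cons, Finset.union_insert]
      exact Finset.subset_insert _ _
    · refine (Finset.card_le_card (t := {v}) ?_).trans_eq (Finset.card_singleton v)
      rw [hL, hU, List.toFinset_cons]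
      grind
  · exact Or.inl ⟨by rw [hL, hU], by simp [hU]⟩

theorem antitone_union (h : IsDFSRun G L U T) : Antitone fun t => U t ∪ (L t).toFinset := by
  refine antitone_nat_of_succ_le fun t => ?_
  rcases h.step_union t with ⟨hW, -⟩ | ⟨-, hW, -⟩
  exacts [hW.le, hW]

end IsDFSRun

/-- From time `a`, the run up to time `T` can be cut at `ℓ` intermediate times into `ℓ + 1` pieces,
in each of which exactly `m` elements leave both `U` and `W`. -/
def EquiCut {V : Type*} [DecidableEq V] (U W : ℕ → Finset V) (T : ℕ) : ℕ → ℕ → ℕ → Prop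
  | 0, a, m => a ≤ T ∧ (U a \ W T).card = m
  | ℓ + 1, a, m => ∃ b, a ≤ b ∧ (U a \ W b).card = m ∧ EquiCut U W T ℓ b m

namespace EquiCut

variable {V : Type*} [DecidableEq V] {U W : ℕ → Finset V} {T ℓ a b m : ℕ}

theorem le (h : EquiCut U W T ℓ a m) : a ≤ T := by
  induction ℓ generalizing a with
  | zero => exact h.1
  | succ ℓ ih =>
    obtain ⟨b, hab, -, hb⟩ := h
    exact hab.trans (ih hb)

theorem eq_zero (hT : U T = ∅) (h : EquiCut U W T ℓ T m) : m = 0 := by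
  cases ℓ with
  | zero => simpa [hT] using h.2.symm
  | succ ℓ =>
    obtain ⟨b, -, hm, -⟩ := h
    simpa [hT] using hm.symm

theorem exists_times (h : EquiCut U W T ℓ a m) :
    ∃ t : ℕ → ℕ, t 0 = a ∧ Monotone t ∧ t (ℓ + 1) = T ∧
      ∀ j ≤ ℓ, (U (t j) \ W (t (j + 1))).card = m := by
  induction ℓ generalizing a with
  | zero =>
    refine ⟨fun j => if j = 0 then a else T, rfl, ?_, rfl, ?_⟩
    · refine monotone_nat_of_le_succ fun j => ?_
      have := h.1
      by_cases hj : j = 0 <;> simp [hj, this]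
    · intro j hj
      obtain rfl := Nat.le_zero.1 hj
      exact h.2
  | succ ℓ ih =>
    obtain ⟨b, hab, hm, hb⟩ := h
    obtain ⟨t, h0, ht, hT, hcard⟩ := ih hb
    refine ⟨fun j => Nat.casesOn j a t, rfl, ?_, hT, ?_⟩
    · refine monotone_nat_of_le_succ fun j => ?_
      cases j with
      | zero => exact hab.trans_eq h0.symm
      | succ j => exact ht j.le_succ
    · intro j hj
      cases j with
      | zero => simpa [h0] using hm
      | succ j => exact hcard j (by omega)

/-- If the attainable piece size drops slowly as the starting time grows, then a cut starting at `b`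
whose pieces are at least as large as the piece between `a` and `b` can be moved to a cut that
includes a piece starting at `a`. -/
theorem exists_succ (hW : Antitone W) (hT : U T = ∅)
    (step : ∀ t, (W (t + 1) = W t ∧ (U t \ U (t + 1)).card ≤ 1) ∨
      (U (t + 1) = U t ∧ (W t \ W (t + 1)).card ≤ 1))
    (drop : ∀ b m, b < T → EquiCut U W T ℓ b m → ∃ m', EquiCut U W T ℓ (b + 1) m' ∧
      m ≤ m' + 1 ∧ (U (b + 1) = U b → m ≤ m'))
    (hab : a ≤ b) (h : EquiCut U W T ℓ b m) (hm : (U a \ W b).card ≤ m) :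
    ∃ m', (U a \ W b).card ≤ m' ∧ EquiCut U W T (ℓ + 1) a m' := by
  induction hk : T - b generalizing b m with
  | zero =>
    obtain rfl : b = T := by have := h.le; omega
    obtain rfl := h.eq_zero hT
    exact ⟨0, hm, b, hab, Nat.le_zero.1 hm, h⟩
  | succ k ih =>
    rcases hm.eq_or_lt with hm | hm
    · exact ⟨m, hm.le, b, hab, hm, h⟩
    obtain ⟨m₁, h₁, hle, heq⟩ := drop b m (by omega) h
    have hmono : (U a \ W b).card ≤ (U a \ W (b + 1)).card :=
      Finset.card_le_card (Finset.sdiff_subset_sdiff le_rfl (hW b.le_succ))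
    have hnew : (U a \ W (b + 1)).card ≤ m₁ := by
      rcases step b with ⟨hs, -⟩ | ⟨hs, hc⟩
      · rw [hs]
        omega
      · have h₂ : U a \ W (b + 1) ⊆ (U a \ W b) ∪ (W b \ W (b + 1)) := by grind
        have := (Finset.card_le_card h₂).trans (Finset.card_union_le _ _)
        have := heq hs
        omega
    obtain ⟨m', hm', hcut⟩ := ih (hab.trans b.le_succ) h₁ hnew (by omega)
    exact ⟨m', hmono.trans hm', hcut⟩

theorem exists_and_drop (hU : Antitone U) (hW : Antitone W) (hUW : ∀ t, U t ⊆ W t)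
    (hT : U T = ∅)
    (step : ∀ t, (W (t + 1) = W t ∧ (U t \ U (t + 1)).card ≤ 1) ∨
      (U (t + 1) = U t ∧ (W t \ W (t + 1)).card ≤ 1)) (ℓ : ℕ) :
    (∀ a ≤ T, ∃ m, EquiCut U W T ℓ a m) ∧
    ∀ a m, a < T → EquiCut U W T ℓ a m → ∃ m', EquiCut U W T ℓ (a + 1) m' ∧
      m ≤ m' + 1 ∧ (U (a + 1) = U a → m ≤ m') := by
  have hdrop : ∀ a b, (U a \ W b).card ≤ (U (a + 1) \ W b).card + 1 := by
    intro a b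
    have h₂ : U a \ W b ⊆ (U (a + 1) \ W b) ∪ (U a \ U (a + 1)) := by grind
    have h₃ := (Finset.card_le_card h₂).trans (Finset.card_union_le _ _)
    have h₄ : (U a \ U (a + 1)).card ≤ 1 := by
      rcases step a with ⟨-, hc⟩ | ⟨hs, -⟩
      · exact hc
      · simp [hs]
    omega
  induction ℓ with
  | zero =>
    refine ⟨fun a ha => ⟨_, ha, rfl⟩, ?_⟩
    rintro a m ha ⟨-, rfl⟩
    exact ⟨_, ⟨ha, rfl⟩, hdrop a T, fun h => by rw [h]⟩
  | succ ℓ ih =>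
    have hex : ∀ a ≤ T, ∃ m, EquiCut U W T (ℓ + 1) a m := by
      intro a ha
      obtain ⟨m, hm⟩ := ih.1 a ha
      have h0 : (U a \ W a).card = 0 := by
        rw [Finset.sdiff_eq_empty_iff_subset.2 (hUW a), Finset.card_empty]
      obtain ⟨m', -, h⟩ := exists_succ hW hT step ih.2 le_rfl hm (h0.trans_le m.zero_le)
      exact ⟨m', h⟩
    refine ⟨hex, ?_⟩
    rintro a m ha ⟨b, hab, hm, hb⟩
    rcases hab.eq_or_lt with rfl | hab
    · rw [Finset.sdiff_eq_empty_iff_subset.2 (hUW a), Finset.card_empty] at hm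
      obtain ⟨m', h⟩ := hex (a + 1) ha
      exact ⟨m', h, by omega, by omega⟩
    · have hle : (U (a + 1) \ W b).card ≤ m := by
        rw [← hm]
        exact Finset.card_le_card (Finset.sdiff_subset_sdiff (hU a.le_succ) le_rfl)
      obtain ⟨m', hm', h⟩ := exists_succ (a := a + 1) hW hT step ih.2 hab hb hle
      refine ⟨m', h, ?_, fun hs => ?_⟩
      · have := hdrop a b
        omega
      · rwa [hs, hm] at hm'

end EquiCut


/-- Pokrovskiy. For any red/blue colouring of `K_n` (blue edges given
by the graph `Blue`, red = the remaining pairs), the vertex set can be partitioned into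
`ℓ` vertex-disjoint blue paths and the vertex classes of a red balanced complete
`(ℓ+1)`-partite graph. -/
theorem stmt11 (n ℓ : ℕ) (hℓ : 1 ≤ ℓ) (Blue : SimpleGraph (Fin n)) :
    ∃ (P : Fin ℓ → List (Fin n)) (A : Fin (ℓ + 1) → Finset (Fin n)),
      (∀ i, (P i).Chain' Blue.Adj ∧ (P i).Nodup) ∧
      (∃ m, ∀ j, (A j).card = m) ∧
      (∀ p q, p ≠ q → ∀ u ∈ A p, ∀ v ∈ A q, ¬ Blue.Adj u v) ∧
      (∀ i j, i ≠ j → Disjoint (P i).toFinset (P j).toFinset) ∧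
      (∀ i j, Disjoint (P i).toFinset (A j)) ∧
      (∀ i j, i ≠ j → Disjoint (A i) (A j)) ∧
      ((Finset.univ.biUnion fun i => (P i).toFinset) ∪
        (Finset.univ.biUnion A) = (Finset.univ : Finset (Fin n))) := by
  obtain ⟨L, U, T, h⟩ := exists_isDFSRun Blue
  obtain ⟨m, hm⟩ := (EquiCut.exists_and_drop (W := fun t => U t ∪ (L t).toFinset) h.antitone
    h.antitone_union (fun t => Finset.subset_union_left) h.final_unvisited
    (fun t => (h.step_union t).imp_right fun hs => ⟨hs.1, hs.2.2⟩) ℓ).1 0 T.zero_le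
  obtain ⟨t, ht0, ht, htT, hcard⟩ := hm.exists_times
  have hanti : ∀ {i j}, i ≤ j → ∀ v ∈ U (t j), v ∈ U (t i) := fun hij v hv =>
    h.antitone (ht hij) hv
  have hLU := fun i => h.notMem_unvisited (t i)
  have hP : ∀ i v, v ∈ ((L (t (i + 1))).filter (· ∈ U (t i))).toFinset ↔
      v ∈ L (t (i + 1)) ∧ v ∈ U (t i) := by simp
  have hA : ∀ j v, v ∈ U (t j) \ (U (t (j + 1)) ∪ (L (t (j + 1))).toFinset) ↔
      v ∈ U (t j) ∧ v ∉ U (t (j + 1)) ∧ v ∉ L (t (j + 1)) := by simp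
  have huniq : ∀ {i j v}, v ∈ U (t i) → v ∉ U (t (i + 1)) → v ∈ U (t j) → v ∉ U (t (j + 1)) →
      i = j := by
    intro i j v hi hi' hj hj'
    rcases lt_trichotomy i j with hij | hij | hij
    · exact absurd (hanti hij v hj) hi'
    · exact hij
    · exact absurd (hanti hij v hi) hj'
  have hred : ∀ p q, p < q → ∀ u ∈ U (t p) \ (U (t (p + 1)) ∪ (L (t (p + 1))).toFinset),
      ∀ v ∈ U (t q), ¬ Blue.Adj u v := by
    intro p q hpq u hu v hv
    rw [hA] at hu
    exact h.not_adj _ u hu.2.1 hu.2.2 v (hanti hpq v hv)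
  refine ⟨fun i => (L (t (i + 1))).filter (· ∈ U (t i)),
    fun j => U (t j) \ (U (t (j + 1)) ∪ (L (t (j + 1))).toFinset),
    fun i => ⟨h.isChain_filter (ht (Nat.le_succ _)), (h.nodup _).filter _⟩,
    ⟨m, fun j => hcard j (Nat.lt_succ_iff.1 j.2)⟩, ?_, ?_, ?_, ?_, ?_⟩
  · intro p q hpq u hu v hv
    rcases lt_or_gt_of_ne (Fin.val_injective.ne hpq) with hlt | hlt
    · exact hred p q hlt u hu v ((hA _ _).1 hv).1
    · exact fun hadj => hred q p hlt v hv u ((hA _ _).1 hu).1 hadj.symm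
  · intro i j hij
    refine Finset.disjoint_left.2 fun v hi hj => hij (Fin.ext ?_)
    rw [hP] at hi hj
    exact huniq hi.2 (hLU _ v hi.1) hj.2 (hLU _ v hj.1)
  · intro i j
    refine Finset.disjoint_left.2 fun v hi hj => ?_
    rw [hP] at hi
    rw [hA] at hj
    exact hj.2.2 (huniq hi.2 (hLU _ v hi.1) hj.1 hj.2.1 ▸ hi.1)
  · intro i j hij
    refine Finset.disjoint_left.2 fun v hi hj => hij (Fin.ext ?_)
    rw [hA] at hi hj
    exact huniq hi.1 hi.2.1 hj.1 hj.2.1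
  · refine Finset.eq_univ_of_forall fun v => ?_
    have hex : ∃ k, v ∉ U (t k) := ⟨ℓ + 1, by simp [htT, h.final_unvisited]⟩
    obtain ⟨j, hj⟩ : ∃ j, Nat.find hex = j + 1 := by
      refine Nat.exists_eq_succ_of_ne_zero fun h0 => ?_
      have := Nat.find_spec hex
      rw [h0, ht0, h.init_unvisited] at this
      exact this (Finset.mem_univ v)
    have hv : v ∈ U (t j) := not_not.1 (Nat.find_min hex (by omega))
    have hv' : v ∉ U (t (j + 1)) := hj ▸ Nat.find_spec hex
    have hjℓ : j + 1 ≤ ℓ + 1 := hj ▸ Nat.find_min' hex (by simp [htT, h.final_unvisited])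
    rw [Finset.mem_union, Finset.mem_biUnion, Finset.mem_biUnion]
    by_cases hL : v ∈ L (t (j + 1))
    · have hne : j ≠ ℓ := by
        rintro rfl
        rw [htT, h.final_stack] at hL
        exact List.not_mem_nil hL
      exact Or.inl ⟨⟨j, by omega⟩, Finset.mem_univ _, (hP j v).2 ⟨hL, hv⟩⟩
    · exact Or.inr ⟨⟨j, hjℓ⟩, Finset.mem_univ _, (hA j v).2 ⟨hv, hv', hL⟩⟩
end

section
/- Let a, b, c, ε be positive reals with a ≥ 2c+1, b ≥ 264a²ε⁻²c⁻², and ε < 1/10, and let t be a positive integer. Then for all sufficiently large n there exists a graph G with: (i) an vertices; (ii) maximum degree at most b; (iii) some f_G > 0 such that every pair of disjoint X, Y ⊆ V(G) with |X| = |Y| = cn satisfies (1−ε)f_G ≤ d(X,Y) ≤ (1+ε)f_G; and (iv) no cycle of length at most 2t. -/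
open scoped Classical

section RandomSubset

variable {α : Type*} [DecidableEq α]

/-- The probability that a random subset of `E`, containing each element independently with
probability `p`, equals `S`. -/
noncomputable def bernoulliWeight (E : Finset α) (p : ℝ) (S : Finset α) : ℝ :=
  p ^ S.card * (1 - p) ^ (E \ S).card

theorem bernoulliWeight_nonneg (E : Finset α) {p : ℝ} (hp0 : 0 ≤ p) (hp1 : p ≤ 1)
    (S : Finset α) : 0 ≤ bernoulliWeight E p S :=
  mul_nonneg (pow_nonneg hp0 _) (pow_nonneg (sub_nonneg.2 hp1) _)

theorem sum_bernoulliWeight_mul_prod (E : Finset α) (p : ℝ) (g h : α → ℝ) :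
    ∑ S ∈ E.powerset, bernoulliWeight E p S * ((∏ e ∈ S, g e) * ∏ e ∈ E \ S, h e) =
      ∏ e ∈ E, (p * g e + (1 - p) * h e) := by
  rw [Finset.prod_add]
  refine Finset.sum_congr rfl fun S _ => ?_
  simp only [bernoulliWeight, Finset.prod_mul_distrib, Finset.prod_const]
  ring

theorem sum_bernoulliWeight (E : Finset α) (p : ℝ) :
    ∑ S ∈ E.powerset, bernoulliWeight E p S = 1 := by
  simpa using sum_bernoulliWeight_mul_prod E p (fun _ => 1) (fun _ => 1)

theorem sum_bernoulliWeight_subset {E C : Finset α} (hC : C ⊆ E) (p : ℝ) :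
    ∑ S ∈ E.powerset, bernoulliWeight E p S * (if C ⊆ S then 1 else 0) = p ^ C.card := by
  have key := sum_bernoulliWeight_mul_prod E p (fun _ => 1) (fun e => if e ∈ C then 0 else 1)
  have hprod : ∏ e ∈ E, (p * 1 + (1 - p) * (if e ∈ C then 0 else 1)) = p ^ C.card := by
    rw [← Finset.prod_const, ← Finset.prod_subset hC]
    · exact Finset.prod_congr rfl fun e he => by simp [he]
    · intro e _ he
      simp [he]
  rw [← hprod, ← key]
  refine Finset.sum_congr rfl fun S _ => ?_
  congr 1
  by_cases h : C ⊆ S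
  · rw [if_pos h, Finset.prod_const_one, one_mul, Finset.prod_eq_one]
    intro e he
    rw [if_neg fun heC => (Finset.mem_sdiff.1 he).2 (h heC)]
  · obtain ⟨e, heC, heS⟩ := Finset.not_subset.1 h
    rw [if_neg h, Finset.prod_eq_zero (i := e) (Finset.mem_sdiff.2 ⟨hC heC, heS⟩) (by simp [heC]),
      mul_zero]

theorem sum_bernoulliWeight_card (E : Finset α) (p : ℝ) :
    ∑ S ∈ E.powerset, bernoulliWeight E p S * (S.card : ℝ) = E.card * p := by
  have h1 : ∀ S ∈ E.powerset, (S.card : ℝ) = ∑ e ∈ E, if {e} ⊆ S then (1 : ℝ) else 0 := by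
    intro S hS
    simp only [Finset.singleton_subset_iff]
    rw [Finset.sum_ite_mem, Finset.inter_eq_right.2 (Finset.mem_powerset.1 hS)]
    simp
  rw [Finset.sum_congr rfl fun S hS => by rw [h1 S hS, Finset.mul_sum], Finset.sum_comm,
    Finset.sum_congr rfl fun e he =>
      sum_bernoulliWeight_subset (Finset.singleton_subset_iff.2 he) p]
  simp

theorem sum_bernoulliWeight_exp {E F : Finset α} (hF : F ⊆ E) (p l : ℝ) :
    ∑ S ∈ E.powerset, bernoulliWeight E p S * Real.exp (l * (S ∩ F).card) =
      (p * Real.exp l + (1 - p)) ^ F.card := by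
  have key := sum_bernoulliWeight_mul_prod E p
    (fun e => if e ∈ F then Real.exp l else 1) (fun _ => 1)
  have hprod : ∏ e ∈ E, (p * (if e ∈ F then Real.exp l else 1) + (1 - p) * 1) =
      (p * Real.exp l + (1 - p)) ^ F.card := by
    rw [← Finset.prod_const, ← Finset.prod_subset hF]
    · exact Finset.prod_congr rfl fun e he => by simp [he]
    · intro e _ he
      simp [he]
  rw [← hprod, ← key]
  refine Finset.sum_congr rfl fun S _ => ?_
  congr 1
  rw [Finset.prod_const_one, mul_one, Finset.prod_ite_mem, Finset.prod_const, ← Real.exp_nat_mul,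
    mul_comm]

theorem sum_bernoulliWeight_exp_le {E F : Finset α} (hF : F ⊆ E) {p l : ℝ} (hp0 : 0 ≤ p)
    (hp1 : p ≤ 1) (hl : |l| ≤ 1) (s : ℝ) :
    ∑ S ∈ E.powerset, bernoulliWeight E p S * Real.exp (l * ((S ∩ F).card - s)) ≤
      Real.exp (F.card * p * (l + l ^ 2) - l * s) := by
  have h1 : ∑ S ∈ E.powerset, bernoulliWeight E p S * Real.exp (l * ((S ∩ F).card - s)) =
      (p * Real.exp l + (1 - p)) ^ F.card * Real.exp (-(l * s)) := by
    rw [← sum_bernoulliWeight_exp hF, Finset.sum_mul]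
    refine Finset.sum_congr rfl fun S _ => ?_
    rw [mul_assoc, ← Real.exp_add]
    ring_nf
  have h2 : p * Real.exp l + (1 - p) ≤ Real.exp (p * (l + l ^ 2)) := by
    have h3 := (abs_le.1 (Real.abs_exp_sub_one_sub_id_le hl)).2
    have h4 := Real.add_one_le_exp (p * (l + l ^ 2))
    nlinarith
  have h5 : 0 ≤ p * Real.exp l + (1 - p) :=
    add_nonneg (mul_nonneg hp0 (Real.exp_pos _).le) (sub_nonneg.2 hp1)
  rw [h1, sub_eq_add_neg (_ * _) (l * s), Real.exp_add]
  refine mul_le_mul_of_nonneg_right ?_ (Real.exp_pos _).le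
  calc _ ≤ Real.exp (p * (l + l ^ 2)) ^ F.card := pow_le_pow_left₀ h5 h2 _
    _ = _ := by rw [← Real.exp_nat_mul, mul_assoc]

/-- First-moment method: a subset of `E` that is small, contains few members of `𝒞`, and meets
each of the `q`-element members of `𝓕` in roughly `q * p` points. -/
theorem exists_subset_card_lt_and_inter_card_near (E : Finset α) (𝒞 𝓕 : Finset (Finset α)) (q : ℕ)
    (h𝒞 : ∀ C ∈ 𝒞, C ⊆ E) (h𝓕 : ∀ F ∈ 𝓕, F ⊆ E ∧ F.card = q) {p δ L D : ℝ}
    (hp0 : 0 ≤ p) (hp1 : p ≤ 1) (hδ0 : 0 < δ) (hδ1 : δ ≤ 1) (hL : 0 < L) (hD : 0 < D)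
    (hsum : E.card * p / L + (∑ C ∈ 𝒞, p ^ C.card) / D +
      𝓕.card * (2 * Real.exp (-(q * p * δ ^ 2 / 4))) < 1) :
    ∃ S ⊆ E, (S.card : ℝ) < L ∧ ((𝒞.filter (· ⊆ S)).card : ℝ) < D ∧
      ∀ F ∈ 𝓕, (1 - δ) * (q * p) < ((S ∩ F).card : ℝ) ∧
        ((S ∩ F).card : ℝ) < (1 + δ) * (q * p) := by
  set up : Finset α → Finset α → ℝ := fun F S =>
    Real.exp (δ / 2 * ((S ∩ F).card - (1 + δ) * (q * p)))
  set lo : Finset α → Finset α → ℝ := fun F S =>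
    Real.exp (-(δ / 2) * ((S ∩ F).card - (1 - δ) * (q * p)))
  have hE : ∑ S ∈ E.powerset, bernoulliWeight E p S *
      (S.card / L + (∑ C ∈ 𝒞, if C ⊆ S then 1 else 0) / D + ∑ F ∈ 𝓕, (up F S + lo F S)) <
      ∑ S ∈ E.powerset, bernoulliWeight E p S := by
    rw [sum_bernoulliWeight]
    refine lt_of_le_of_lt ?_ hsum
    simp only [mul_add, Finset.sum_add_distrib]
    refine add_le_add (add_le_add (le_of_eq ?_) (le_of_eq ?_)) ?_
    · simp only [← mul_div_assoc]
      rw [← Finset.sum_div, sum_bernoulliWeight_card]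
    · simp only [← mul_div_assoc, Finset.mul_sum]
      rw [← Finset.sum_div, Finset.sum_comm]
      congr 1
      exact Finset.sum_congr rfl fun C hC => sum_bernoulliWeight_subset (h𝒞 C hC) p
    · rw [two_mul, mul_add]
      refine add_le_add ?_ ?_
      all_goals
        simp only [Finset.mul_sum]
        rw [Finset.sum_comm, ← nsmul_eq_mul]
        refine Finset.sum_le_card_nsmul _ _ _ fun F hF => ?_
        obtain ⟨hFE, hFq⟩ := h𝓕 F hF
        refine (sum_bernoulliWeight_exp_le hFE hp0 hp1
          (by rw [abs_le]; constructor <;> linarith) _).trans (le_of_eq ?_)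
        rw [hFq]
        ring_nf
  obtain ⟨S, hS, hlt⟩ := Finset.exists_lt_of_sum_lt hE
  have hΦ := lt_of_mul_lt_mul_left (hlt.trans_eq (mul_one _).symm)
    (bernoulliWeight_nonneg E hp0 hp1 S)
  have hcount : (∑ C ∈ 𝒞, if C ⊆ S then (1 : ℝ) else 0) = (𝒞.filter (· ⊆ S)).card := by
    simp
  rw [hcount] at hΦ
  have hA : 0 ≤ (S.card : ℝ) / L := by positivity
  have hB : 0 ≤ ((𝒞.filter (· ⊆ S)).card : ℝ) / D := by positivity
  have hpos : ∀ F ∈ 𝓕, 0 ≤ up F S + lo F S := fun F _ =>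
    add_nonneg (Real.exp_pos _).le (Real.exp_pos _).le
  have hC : 0 ≤ ∑ F ∈ 𝓕, (up F S + lo F S) := Finset.sum_nonneg hpos
  refine ⟨S, Finset.mem_powerset.1 hS, ?_, ?_, fun F hF => ?_⟩
  · rw [← div_lt_one hL]
    linarith
  · rw [← div_lt_one hD]
    linarith
  · have hF1 := Finset.single_le_sum hpos hF
    have hu : up F S < 1 := by linarith [Real.exp_pos (-(δ / 2) * ((S ∩ F).card - (1 - δ) * (q * p)))]
    have hl : lo F S < 1 := by linarith [Real.exp_pos (δ / 2 * ((S ∩ F).card - (1 + δ) * (q * p)))]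
    have hu' := Real.exp_lt_one_iff.1 hu
    have hl' := Real.exp_lt_one_iff.1 hl
    constructor <;> nlinarith

/-- Deleting one element from every member of `𝒞` contained in `S`. -/
theorem exists_subset_forall_not_subset (𝒞 : Finset (Finset α)) (h𝒞 : ∀ C ∈ 𝒞, C.Nonempty)
    (S : Finset α) :
    ∃ T ⊆ S, (S \ T).card ≤ (𝒞.filter (· ⊆ S)).card ∧ ∀ C ∈ 𝒞, ¬ C ⊆ T := by
  obtain rfl | ⟨C₀, hC₀⟩ := 𝒞.eq_empty_or_nonempty
  · exact ⟨S, subset_rfl, by simp, by simp⟩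
  have : Nonempty α := (h𝒞 C₀ hC₀).to_type
  choose! x hx using h𝒞
  refine ⟨S \ (𝒞.filter (· ⊆ S)).image x, Finset.sdiff_subset, ?_, fun C hC hCT => ?_⟩
  · rw [Finset.sdiff_sdiff_self_left]
    exact (Finset.card_le_card Finset.inter_subset_right).trans Finset.card_image_le
  · refine (Finset.mem_sdiff.1 (hCT (hx C hC))).2 (Finset.mem_image_of_mem x ?_)
    exact Finset.mem_filter.2 ⟨hC, hCT.trans Finset.sdiff_subset⟩

end RandomSubset

section CycleEdgeSets

variable {V : Type*} [Fintype V] [DecidableEq V]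

theorem card_finsetWalkLength_succ_le (G : SimpleGraph V) [DecidableRel G.Adj] (k : ℕ) (u v : V) :
    (G.finsetWalkLength (k + 1) u v).card ≤ Fintype.card V ^ k := by
  induction k generalizing u with
  | zero =>
    rw [pow_zero, Finset.card_le_one]
    intro p hp q hq
    rw [SimpleGraph.mem_finsetWalkLength_iff] at hp hq
    match p, q, hp, hq with
    | .cons _ .nil, .cons _ .nil, _, _ => rfl
  | succ k ih =>
    rw [SimpleGraph.finsetWalkLength, pow_succ']
    refine Finset.card_biUnion_le.trans ?_
    simp only [Finset.card_map]
    refine (Finset.sum_le_card_nsmul _ _ _ fun w _ => ih w.1).trans ?_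
    rw [smul_eq_mul, Finset.card_univ]
    exact Nat.mul_le_mul_right _ (Fintype.card_subtype_le _)

/-- The edge sets of all cycles of length `k` on the vertex set `V`. -/
noncomputable def cycleEdgeSets (V : Type*) [Fintype V] [DecidableEq V] (k : ℕ) :
    Finset (Finset (Sym2 V)) :=
  Finset.univ.biUnion fun v =>
    (((⊤ : SimpleGraph V).finsetWalkLength k v v).filter (·.IsCycle)).image (·.edges.toFinset)

theorem card_cycleEdgeSets_le {k : ℕ} (hk : 1 ≤ k) :
    (cycleEdgeSets V k).card ≤ Fintype.card V ^ k := by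
  obtain ⟨k, rfl⟩ := Nat.exists_eq_add_of_le' hk
  rw [pow_succ']
  refine Finset.card_biUnion_le.trans ((Finset.sum_le_card_nsmul _ _ _ fun v _ =>
    Finset.card_image_le.trans ((Finset.card_filter_le _ _).trans
      (card_finsetWalkLength_succ_le _ k v v))).trans ?_)
  rw [smul_eq_mul, Finset.card_univ]

theorem card_of_mem_cycleEdgeSets {k : ℕ} {C : Finset (Sym2 V)} (hC : C ∈ cycleEdgeSets V k) :
    C.card = k := by
  simp only [cycleEdgeSets, Finset.mem_biUnion, Finset.mem_image, Finset.mem_filter,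
    SimpleGraph.mem_finsetWalkLength_iff] at hC
  obtain ⟨v, -, w, ⟨hw, hcyc⟩, rfl⟩ := hC
  rw [List.toFinset_card_of_nodup hcyc.edges_nodup, SimpleGraph.Walk.length_edges, hw]

theorem subset_of_mem_cycleEdgeSets {k : ℕ} {C : Finset (Sym2 V)} (hC : C ∈ cycleEdgeSets V k) :
    C ⊆ (⊤ : SimpleGraph V).edgeFinset := by
  simp only [cycleEdgeSets, Finset.mem_biUnion, Finset.mem_image] at hC
  obtain ⟨v, -, w, -, rfl⟩ := hC
  intro e he
  exact SimpleGraph.mem_edgeFinset.2 (w.edges_subset_edgeSet (List.mem_toFinset.1 he))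

theorem edges_toFinset_mem_cycleEdgeSets {G : SimpleGraph V} {v : V} {w : G.Walk v v}
    (hw : w.IsCycle) : w.edges.toFinset ∈ cycleEdgeSets V w.length := by
  simp only [cycleEdgeSets, Finset.mem_biUnion, Finset.mem_image, Finset.mem_filter,
    SimpleGraph.mem_finsetWalkLength_iff]
  refine ⟨v, Finset.mem_univ v, w.mapLe le_top, ⟨?_, hw.mapLe le_top⟩, ?_⟩
  · exact SimpleGraph.Walk.length_map _ _
  · rw [SimpleGraph.Walk.edges_mapLe_eq_edges]

theorem sum_pow_card_cycleEdgeSets_le {p : ℝ} (hp : 0 ≤ p) (l : ℕ) :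
    ∑ C ∈ (Finset.Icc 1 l).biUnion (cycleEdgeSets V), p ^ C.card ≤
      ∑ k ∈ Finset.Icc 1 l, (Fintype.card V * p) ^ k := by
  rw [Finset.sum_biUnion]
  · refine Finset.sum_le_sum fun k hk => ?_
    rw [Finset.sum_congr rfl fun C hC => by rw [card_of_mem_cycleEdgeSets hC], Finset.sum_const,
      nsmul_eq_mul, mul_pow]
    exact mul_le_mul_of_nonneg_right
      (by exact_mod_cast card_cycleEdgeSets_le (Finset.mem_Icc.1 hk).1) (pow_nonneg hp k)
  · intro i _ j _ hij
    refine Finset.disjoint_left.2 fun C hi hj => hij ?_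
    rw [← card_of_mem_cycleEdgeSets hi, card_of_mem_cycleEdgeSets hj]

end CycleEdgeSets

section Graphs

variable {V : Type*}

theorem injOn_sym2Mk_of_disjoint {X Y : Finset V} (h : Disjoint X Y) :
    Set.InjOn (fun x : V × V => s(x.1, x.2)) (X ×ˢ Y : Finset (V × V)) := by
  rintro ⟨x, y⟩ hxy ⟨x', y'⟩ hxy' heq
  simp only [Finset.coe_product, Set.mem_prod, Finset.mem_coe] at hxy hxy'
  rcases Sym2.eq_iff.1 heq with ⟨rfl, rfl⟩ | ⟨rfl, rfl⟩
  · rfl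
  · exact absurd hxy'.2 (Finset.disjoint_left.1 h hxy.1)

theorem card_interedges_of_disjoint [DecidableEq V] (G : SimpleGraph V) [DecidableRel G.Adj] {X Y : Finset V}
    (h : Disjoint X Y) {T : Finset (Sym2 V)} (hT : G.edgeSet = T) :
    (G.interedges X Y).card = (T ∩ (X ×ˢ Y).image fun x => s(x.1, x.2)).card := by
  rw [SimpleGraph.interedges_def, ← Finset.card_image_of_injOn
    ((injOn_sym2Mk_of_disjoint h).mono (Finset.coe_subset.2 (Finset.filter_subset _ _)))]
  congr 1
  ext e
  have hadj : ∀ x y, G.Adj x y ↔ s(x, y) ∈ T := fun x y => by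
    rw [← SimpleGraph.mem_edgeSet, hT, Finset.mem_coe]
  simp only [Finset.mem_image, Finset.mem_inter, Finset.mem_filter, Finset.mem_product, hadj]
  constructor
  · rintro ⟨x, ⟨⟨h1, h2⟩, h3⟩, rfl⟩
    exact ⟨h3, x, ⟨h1, h2⟩, rfl⟩
  · rintro ⟨h3, x, ⟨h1, h2⟩, rfl⟩
    exact ⟨x, ⟨⟨h1, h2⟩, h3⟩, rfl⟩

/-- Sparse graph with few edges, without short cycles, in which any two disjoint `m`-element sets
of vertices span roughly `m ^ 2 * p` edges. -/
theorem exists_graph_card_interedges_near [Fintype V] [DecidableEq V] (m l : ℕ) {p δ L D : ℝ}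
    (hp0 : 0 ≤ p) (hp1 : p ≤ 1) (hδ0 : 0 < δ) (hδ1 : δ ≤ 1) (hL : 0 < L) (hD : 0 < D)
    (hsum : (Fintype.card V) ^ 2 / 2 * p / L + (∑ k ∈ Finset.Icc 1 l, (Fintype.card V * p) ^ k) / D +
      4 ^ Fintype.card V * (2 * Real.exp (-(m ^ 2 * p * δ ^ 2 / 4))) < 1) :
    ∃ G : SimpleGraph V, (G.edgeFinset.card : ℝ) < L ∧
      (∀ X Y : Finset V, Disjoint X Y → X.card = m → Y.card = m →
        (1 - δ) * (m ^ 2 * p) - D < ((G.interedges X Y).card : ℝ) ∧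
          ((G.interedges X Y).card : ℝ) < (1 + δ) * (m ^ 2 * p)) ∧
      ∀ (v : V) (w : G.Walk v v), w.IsCycle → l < w.length := by
  set E := (⊤ : SimpleGraph V).edgeFinset with hE
  set 𝒞 := (Finset.Icc 1 l).biUnion (cycleEdgeSets V)
  set cross : Finset V × Finset V → Finset (Sym2 V) :=
    fun XY => (XY.1 ×ˢ XY.2).image fun x => s(x.1, x.2) with hcross
  set P : Finset (Finset V × Finset V) :=
    Finset.univ.filter fun XY => Disjoint XY.1 XY.2 ∧ XY.1.card = m ∧ XY.2.card = m
  have h𝒞E : ∀ C ∈ 𝒞, C ⊆ E := fun C hC => by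
    obtain ⟨k, -, hk⟩ := Finset.mem_biUnion.1 hC
    exact subset_of_mem_cycleEdgeSets hk
  have h𝒞ne : ∀ C ∈ 𝒞, C.Nonempty := fun C hC => by
    obtain ⟨k, hkl, hk⟩ := Finset.mem_biUnion.1 hC
    rw [← Finset.card_pos, card_of_mem_cycleEdgeSets hk]
    exact (Finset.mem_Icc.1 hkl).1
  have h𝓕 : ∀ F ∈ P.image cross, F ⊆ E ∧ F.card = m ^ 2 := by
    intro F hF
    obtain ⟨⟨X, Y⟩, hXY, rfl⟩ := Finset.mem_image.1 hF
    obtain ⟨-, hdisj, hX, hY⟩ := Finset.mem_filter.1 hXY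
    refine ⟨fun e he => ?_, ?_⟩
    · obtain ⟨⟨x, y⟩, hxy, rfl⟩ := Finset.mem_image.1 he
      obtain ⟨hx, hy⟩ := Finset.mem_product.1 hxy
      simp only [hE, SimpleGraph.mem_edgeFinset, SimpleGraph.mem_edgeSet, SimpleGraph.top_adj]
      exact fun hxy => Finset.disjoint_left.1 hdisj hx (hxy ▸ hy)
    · rw [hcross, Finset.card_image_of_injOn (injOn_sym2Mk_of_disjoint hdisj),
        Finset.card_product, hX, hY, sq]
  have hEcard : (E.card : ℝ) ≤ (Fintype.card V) ^ 2 / 2 := by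
    rw [hE, SimpleGraph.card_edgeFinset_top_eq_card_choose_two]
    exact (Nat.choose_le_pow_div 2 _).trans (by norm_num)
  have hPcard : ((P.image cross).card : ℝ) ≤ 4 ^ Fintype.card V := by
    have h1 : (P.image cross).card ≤ 4 ^ Fintype.card V := by
      refine Finset.card_image_le.trans ((Finset.card_filter_le _ _).trans (le_of_eq ?_))
      rw [Finset.card_univ, Fintype.card_prod, Fintype.card_finset, ← mul_pow]
      norm_num
    exact_mod_cast h1
  obtain ⟨S, hSE, hSL, hSC, hSF⟩ := exists_subset_card_lt_and_inter_card_near E 𝒞 (P.image cross)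
    (m ^ 2) h𝒞E h𝓕 hp0 hp1 hδ0 hδ1 hL hD (by
      refine lt_of_le_of_lt ?_ hsum
      rw [Nat.cast_pow]
      gcongr
      exact sum_pow_card_cycleEdgeSets_le hp0 l)
  obtain ⟨T, hTS, hST, hTC⟩ := exists_subset_forall_not_subset 𝒞 h𝒞ne S
  obtain ⟨G, hGT⟩ : ∃ G : SimpleGraph V, G.edgeSet = T := by
    refine ⟨SimpleGraph.fromEdgeSet T, ?_⟩
    rw [SimpleGraph.edgeSet_fromEdgeSet, sdiff_eq_left, Set.disjoint_left]
    exact fun e he => SimpleGraph.not_isDiag_of_mem_edgeSet _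
      (SimpleGraph.mem_edgeFinset.1 (hSE (hTS he)))
  refine ⟨G, ?_, fun X Y hdisj hX hY => ?_, fun v w hw => ?_⟩
  · refine lt_of_le_of_lt (Nat.cast_le.2 (Finset.card_le_card fun e he => hTS ?_)) hSL
    rw [← Finset.mem_coe, ← hGT]
    exact SimpleGraph.mem_edgeFinset.1 he
  · have hF := hSF (cross (X, Y)) (Finset.mem_image_of_mem _
      (Finset.mem_filter.2 ⟨Finset.mem_univ _, hdisj, hX, hY⟩))
    rw [card_interedges_of_disjoint G hdisj hGT]
    rw [Nat.cast_pow] at hF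
    have h1 : ((T ∩ cross (X, Y)).card : ℝ) ≤ (S ∩ cross (X, Y)).card := by
      exact_mod_cast Finset.card_le_card (Finset.inter_subset_inter_right hTS)
    have h2 : ((S ∩ cross (X, Y)).card : ℝ) ≤ (T ∩ cross (X, Y)).card + (S \ T).card := by
      have : S ∩ cross (X, Y) ⊆ (T ∩ cross (X, Y)) ∪ (S \ T) := by
        intro e he
        simp only [Finset.mem_union, Finset.mem_inter, Finset.mem_sdiff] at he ⊢
        tauto
      exact_mod_cast (Finset.card_le_card this).trans (Finset.card_union_le _ _)
    have h3 : ((S \ T).card : ℝ) ≤ (𝒞.filter (· ⊆ S)).card := by exact_mod_cast hST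
    exact ⟨by linarith [hF.1], by linarith [hF.2]⟩
  · by_contra! hlen
    refine hTC w.edges.toFinset (Finset.mem_biUnion.2
      ⟨w.length, Finset.mem_Icc.2 ⟨?_, hlen⟩, edges_toFinset_mem_cycleEdgeSets hw⟩) fun e he => ?_
    · exact le_trans (by norm_num) hw.three_le_length
    · rw [← Finset.mem_coe, ← hGT]
      exact w.edges_subset_edgeSet (List.mem_toFinset.1 he)

/-- In a graph on `2 * K` vertices with at most `K * b / 2` edges, some `K` vertices have degree
at most `b`. -/
theorem exists_embedding_degree_le [Fintype V] (G : SimpleGraph V) [DecidableRel G.Adj] {K : ℕ}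
    (hV : Fintype.card V = 2 * K) {b : ℝ} (hb : 0 < b) (hG : (G.edgeFinset.card : ℝ) ≤ K * b / 2) :
    ∃ φ : Fin K ↪ V, ∀ i, (G.degree (φ i) : ℝ) ≤ b := by
  set A := Finset.univ.filter fun v => (G.degree v : ℝ) ≤ b with hA
  have hhigh : ((Finset.univ.filter fun v => ¬ (G.degree v : ℝ) ≤ b).card : ℝ) * b ≤ K * b := by
    have h1 : ((∑ v, G.degree v : ℕ) : ℝ) = 2 * G.edgeFinset.card := by
      exact_mod_cast G.sum_degrees_eq_twice_card_edges
    calc _ ≤ ∑ v ∈ Finset.univ.filter fun v => ¬ (G.degree v : ℝ) ≤ b, (G.degree v : ℝ) := by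
          rw [← nsmul_eq_mul]
          exact Finset.card_nsmul_le_sum _ _ _ fun v hv => (not_le.1 (Finset.mem_filter.1 hv).2).le
      _ ≤ ∑ v, (G.degree v : ℝ) :=
          Finset.sum_le_sum_of_subset_of_nonneg (Finset.filter_subset _ _) fun _ _ _ => by positivity
      _ ≤ _ := by
          rw [← Nat.cast_sum, h1]
          linarith
  have hhigh' : (Finset.univ.filter fun v => ¬ (G.degree v : ℝ) ≤ b).card ≤ K := by
    exact_mod_cast le_of_mul_le_mul_right hhigh hb
  have hcard : K ≤ A.card := by
    have := Finset.card_filter_add_card_filter_not (s := (Finset.univ : Finset V))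
      (fun v => (G.degree v : ℝ) ≤ b)
    rw [Finset.card_univ, hV, ← hA] at this
    omega
  obtain ⟨φ⟩ : Nonempty (Fin K ↪ A) := Function.Embedding.nonempty_of_card_le (by simpa using hcard)
  exact ⟨φ.trans (Function.Embedding.subtype _), fun i => (Finset.mem_filter.1 (φ i).2).2⟩

theorem degree_comap_le {W : Type*} [Fintype V] [Fintype W] (G : SimpleGraph V) [DecidableRel G.Adj]
    (φ : W ↪ V) [DecidableRel (G.comap φ).Adj] (w : W) :
    (G.comap φ).degree w ≤ G.degree (φ w) := by
  rw [← SimpleGraph.card_neighborFinset_eq_degree, ← SimpleGraph.card_neighborFinset_eq_degree,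
    ← Finset.card_map φ]
  refine Finset.card_le_card fun v hv => ?_
  obtain ⟨u, hu, rfl⟩ := Finset.mem_map.1 hv
  simpa using hu

theorem card_interedges_comap {W : Type*} (G : SimpleGraph V) [DecidableRel G.Adj]
    (φ : W ↪ V) [DecidableRel (G.comap φ).Adj] (X Y : Finset W) :
    ((G.comap φ).interedges X Y).card = (G.interedges (X.map φ) (Y.map φ)).card := by
  rw [← Finset.card_map (φ.prodMap φ)]
  congr 1
  ext ⟨x, y⟩
  simp only [Finset.mem_map, SimpleGraph.mem_interedges_iff, Prod.exists,
    Function.Embedding.coe_prodMap, Prod.map_apply, Prod.mk.injEq, SimpleGraph.comap_adj]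
  constructor
  · rintro ⟨u, v, ⟨hu, hv, h⟩, rfl, rfl⟩
    exact ⟨⟨u, hu, rfl⟩, ⟨v, hv, rfl⟩, h⟩
  · rintro ⟨⟨u, hu, rfl⟩, ⟨v, hv, rfl⟩, h⟩
    exact ⟨u, v, ⟨hu, hv, h⟩, rfl, rfl⟩

end Graphs

section Parameters

theorem sum_failure_lt_one {a b c ε : ℝ} (ha : 0 < a) (hb : 0 < b) (hc : 0 < c) (hε : 0 < ε)
    (hab : 264 * a ^ 2 * ε⁻¹ ^ 2 * c⁻¹ ^ 2 ≤ b) {K m l : ℕ} (hm : 0 < m) (hK : 3 ≤ K)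
    (hKm : 5 * c * K ≤ 6 * a * m)
    (hKl : 4 / 3 * ε * ∑ k ∈ Finset.Icc 1 l, (87 * a ^ 2 / (ε ^ 2 * c ^ 2)) ^ k ≤ K) :
    ((2 * K : ℕ) : ℝ) ^ 2 / 2 * (30 * K / (ε ^ 2 * m ^ 2)) / (K * b / 2) +
      (∑ k ∈ Finset.Icc 1 l, (((2 * K : ℕ) : ℝ) * (30 * K / (ε ^ 2 * m ^ 2))) ^ k) /
        (15 / 2 * K / ε) +
      4 ^ (2 * K) *
        (2 * Real.exp (-(m ^ 2 * (30 * K / (ε ^ 2 * m ^ 2)) * (3 / 4 * ε) ^ 2 / 4))) < 1 := by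
  have hm' : (0 : ℝ) < m := by exact_mod_cast hm
  have hK' : (0 : ℝ) < K := by exact_mod_cast (by omega : 0 < K)
  have hsq : 25 * c ^ 2 * (K : ℝ) ^ 2 ≤ 36 * a ^ 2 * m ^ 2 := by
    have := pow_le_pow_left₀ (by positivity) hKm 2
    nlinarith
  have hbc : 264 * a ^ 2 ≤ b * (ε ^ 2 * c ^ 2) := by
    rw [← div_le_iff₀ (by positivity)]
    refine le_trans (le_of_eq ?_) hab
    field_simp
  have hedges : ((2 * K : ℕ) : ℝ) ^ 2 / 2 * (30 * K / (ε ^ 2 * m ^ 2)) / (K * b / 2) ≤ 66 / 100 := by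
    have h1 : ((2 * K : ℕ) : ℝ) ^ 2 / 2 * (30 * K / (ε ^ 2 * m ^ 2)) / (K * b / 2) =
        120 * K ^ 2 / (ε ^ 2 * m ^ 2 * b) := by
      push_cast
      field_simp
      ring
    rw [h1, div_le_iff₀ (by positivity)]
    have h2 : 25 * c ^ 2 * (264 * (K : ℝ) ^ 2) ≤ 25 * c ^ 2 * (36 / 25 * (ε ^ 2 * m ^ 2 * b)) := by
      have h3 := mul_le_mul_of_nonneg_right hbc (sq_nonneg (m : ℝ))
      nlinarith [show (0 : ℝ) ≤ b * (ε ^ 2 * c ^ 2) * m ^ 2 by positivity]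
    have h4 := le_of_mul_le_mul_left h2 (by positivity)
    nlinarith [show (0 : ℝ) ≤ ε ^ 2 * m ^ 2 * b by positivity]
  have hcycles : (∑ k ∈ Finset.Icc 1 l, (((2 * K : ℕ) : ℝ) * (30 * K / (ε ^ 2 * m ^ 2))) ^ k) /
      (15 / 2 * K / ε) ≤ 1 / 10 := by
    have h1 : ((2 * K : ℕ) : ℝ) * (30 * K / (ε ^ 2 * m ^ 2)) ≤ 87 * a ^ 2 / (ε ^ 2 * c ^ 2) := by
      rw [← mul_div_assoc, div_le_div_iff₀ (by positivity) (by positivity)]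
      push_cast
      have h2 := mul_le_mul_of_nonneg_right hsq (sq_nonneg ε)
      nlinarith [show (0 : ℝ) ≤ a ^ 2 * m ^ 2 * ε ^ 2 by positivity]
    rw [div_le_iff₀ (by positivity)]
    calc _ ≤ ∑ k ∈ Finset.Icc 1 l, (87 * a ^ 2 / (ε ^ 2 * c ^ 2)) ^ k :=
          Finset.sum_le_sum fun k _ => pow_le_pow_left₀ (by positivity) h1 k
      _ ≤ 3 / 4 * (K / ε) := by
          rw [← mul_div_assoc, le_div_iff₀ hε]
          linarith
      _ = _ := by ring
  have hpairs : (4 : ℝ) ^ (2 * K) *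
      (2 * Real.exp (-(m ^ 2 * (30 * K / (ε ^ 2 * m ^ 2)) * (3 / 4 * ε) ^ 2 / 4))) ≤ 2 / 27 := by
    have h1 : (m : ℝ) ^ 2 * (30 * K / (ε ^ 2 * m ^ 2)) * (3 / 4 * ε) ^ 2 / 4 = K * (135 / 32) := by
      field_simp
      ring
    have h2 : Real.exp (-(K * (135 / 32))) ≤ (1 / 48 : ℝ) ^ K := by
      rw [← mul_neg, Real.exp_nat_mul]
      refine pow_le_pow_left₀ (Real.exp_pos _).le ?_ K
      rw [Real.exp_neg, one_div]
      refine inv_anti₀ (by norm_num) ?_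
      calc (48 : ℝ) ≤ 2.7 ^ 4 := by norm_num
        _ ≤ Real.exp 1 ^ 4 :=
          pow_le_pow_left₀ (by norm_num) (by linarith [Real.exp_one_gt_d9]) 4
        _ = Real.exp 4 := by rw [← Real.exp_nat_mul]; norm_num
        _ ≤ _ := Real.exp_le_exp.2 (by norm_num)
    rw [h1]
    calc _ ≤ (4 : ℝ) ^ (2 * K) * (2 * (1 / 48 : ℝ) ^ K) := by gcongr
      _ = 2 * (1 / 3 : ℝ) ^ K := by
          rw [pow_mul, mul_left_comm, ← mul_pow]
          norm_num
      _ ≤ 2 * (1 / 3 : ℝ) ^ 3 :=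
          mul_le_mul_of_nonneg_left
            (pow_le_pow_of_le_one (by norm_num) (by norm_num) hK) (by norm_num)
      _ = _ := by norm_num
  linarith

end Parameters

theorem exists_sparse_uniform_graph {b ε p D : ℝ} {K m l : ℕ} (hb : 0 < b) (hε : 0 < ε)
    (hε1 : ε ≤ 1) (hK : 0 < K) (hm : 0 < m) (hp0 : 0 < p) (hp1 : p ≤ 1) (hD : 0 < D)
    (hDp : D = ε / 4 * (m ^ 2 * p))
    (hsum : ((2 * K : ℕ) : ℝ) ^ 2 / 2 * p / (K * b / 2) +
      (∑ k ∈ Finset.Icc 1 l, (((2 * K : ℕ) : ℝ) * p) ^ k) / D +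
      4 ^ (2 * K) * (2 * Real.exp (-(m ^ 2 * p * (3 / 4 * ε) ^ 2 / 4))) < 1) :
    ∃ G : SimpleGraph (Fin K), (∀ v, (G.degree v : ℝ) ≤ b) ∧
      (∀ X Y : Finset (Fin K), Disjoint X Y → X.card = m → Y.card = m →
        (1 - ε) * p ≤ (G.edgeDensity X Y : ℝ) ∧ (G.edgeDensity X Y : ℝ) ≤ (1 + ε) * p) ∧
      ∀ (v : Fin K) (w : G.Walk v v), w.IsCycle → l < w.length := by
  have hK' : (0 : ℝ) < K := by exact_mod_cast hK
  have hm' : (0 : ℝ) < m := by exact_mod_cast hm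
  obtain ⟨H, hHcard, hHinter, hHcycle⟩ := exists_graph_card_interedges_near (V := Fin (2 * K)) m l
    (δ := 3 / 4 * ε) (L := K * b / 2) (D := D) hp0.le hp1 (by positivity) (by linarith)
    (by positivity) hD (by simpa only [Fintype.card_fin] using hsum)
  obtain ⟨φ, hφ⟩ := exists_embedding_degree_le H (Fintype.card_fin _) hb hHcard.le
  refine ⟨H.comap φ, fun v => ?_, fun X Y hdisj hX hY => ?_, fun v w hw => ?_⟩
  · exact (Nat.cast_le.2 (degree_comap_le H φ v)).trans (hφ v)
  · have hXY := hHinter (X.map φ) (Y.map φ) ((Finset.disjoint_map φ).2 hdisj)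
      (by rw [Finset.card_map, hX]) (by rw [Finset.card_map, hY])
    rw [SimpleGraph.edgeDensity_def, hX, hY, @card_interedges_comap _ _ H _ φ (_) X Y]
    push_cast
    rw [le_div_iff₀ (by positivity), div_le_iff₀ (by positivity)]
    have hmp : 0 < (m : ℝ) ^ 2 * p := by positivity
    constructor <;> nlinarith [mul_pos hε hmp]
  · have := hHcycle _ (w.map (SimpleGraph.Embedding.comap φ H).toHom)
      (hw.map (SimpleGraph.Embedding.comap φ H).injective)
    rwa [SimpleGraph.Walk.length_map] at this

/-- existence of pseudorandom graphs. For every good quadruple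
`(a,b,c,ε)` and every `t ≥ 1`, for all sufficiently large `n` there is a graph on
`⌊an⌋` vertices with maximum degree at most `b`, uniform density `(1±ε)f_G` between
disjoint sets of `⌊cn⌋` vertices, and no cycle of length at most `2t`. -/
theorem stmt16 (a b c ε : ℝ) (ha : 0 < a) (hb : 0 < b) (hc : 0 < c) (hε : 0 < ε)
    (hgood1 : 2 * c + 1 ≤ a) (hgood2 : 264 * a ^ 2 * ε⁻¹ ^ 2 * c⁻¹ ^ 2 ≤ b)
    (hgood3 : ε < 1 / 10) (t : ℕ) (ht : 1 ≤ t) :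
    ∃ n₀ : ℕ, ∀ n : ℕ, n₀ ≤ n →
      ∃ G : SimpleGraph (Fin ⌊a * n⌋₊),
        (∀ v, (G.degree v : ℝ) ≤ b) ∧
        (∃ f : ℝ, 0 < f ∧ ∀ X Y : Finset (Fin ⌊a * n⌋₊), Disjoint X Y →
          X.card = ⌊c * n⌋₊ → Y.card = ⌊c * n⌋₊ →
          (1 - ε) * f ≤ (G.edgeDensity X Y : ℝ) ∧
            (G.edgeDensity X Y : ℝ) ≤ (1 + ε) * f) ∧
        (∀ (v : Fin ⌊a * n⌋₊) (w : G.Walk v v), w.IsCycle → 2 * t < w.length) := by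
  obtain ⟨n₁, hn₁⟩ := exists_nat_ge (7 / c)
  obtain ⟨n₂, hn₂⟩ := exists_nat_ge ((36 * a / (c * ε ^ 2) + 1) / c)
  obtain ⟨n₃, hn₃⟩ := exists_nat_ge
    ((4 / 3 * ε * ∑ k ∈ Finset.Icc 1 (2 * t), (87 * a ^ 2 / (ε ^ 2 * c ^ 2)) ^ k + 4) / a)
  refine ⟨max n₁ (max n₂ n₃), fun n hn => ?_⟩
  have hn1 : (n₁ : ℝ) ≤ n := by exact_mod_cast (le_max_left _ _).trans hn
  have hn2 : (n₂ : ℝ) ≤ n := by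
    exact_mod_cast ((le_max_left _ _).trans (le_max_right _ _)).trans hn
  have hn3 : (n₃ : ℝ) ≤ n := by
    exact_mod_cast ((le_max_right _ _).trans (le_max_right _ _)).trans hn
  replace hn1 := (div_le_iff₀' hc).1 (hn₁.trans hn1)
  replace hn2 := (div_le_iff₀' hc).1 (hn₂.trans hn2)
  replace hn3 := (div_le_iff₀' ha).1 (hn₃.trans hn3)
  have hKle : (⌊a * n⌋₊ : ℝ) ≤ a * n := Nat.floor_le (by positivity)
  have hKgt : a * n < ⌊a * n⌋₊ + 1 := Nat.lt_floor_add_one _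
  have hmgt : c * n < ⌊c * n⌋₊ + 1 := Nat.lt_floor_add_one _
  set K := ⌊a * n⌋₊
  set m := ⌊c * n⌋₊
  have hsum0 : 0 ≤ 4 / 3 * ε * ∑ k ∈ Finset.Icc 1 (2 * t), (87 * a ^ 2 / (ε ^ 2 * c ^ 2)) ^ k := by
    positivity
  have hK3 : 3 ≤ K := by
    have : (3 : ℝ) < K := by linarith
    exact_mod_cast this.le
  have hm' : (0 : ℝ) < m := by linarith
  have hm : 0 < m := by exact_mod_cast hm'
  have hK' : (0 : ℝ) < K := by exact_mod_cast (by omega : 0 < K)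
  have hKm : 5 * c * K ≤ 6 * a * m := by
    have h1 := mul_le_mul_of_nonneg_left hKle hc.le
    have h2 : a * (c * n - 1) ≤ a * m := mul_le_mul_of_nonneg_left (by linarith) ha.le
    have h3 : a * 7 ≤ a * (c * n) := mul_le_mul_of_nonneg_left hn1 ha.le
    nlinarith
  have hp1 : 30 * K / (ε ^ 2 * m ^ 2) ≤ 1 := by
    have h1 : 36 * a ≤ m * (c * ε ^ 2) := (div_le_iff₀ (by positivity)).1 (by linarith)
    have h2 := mul_le_mul_of_nonneg_right h1 hm'.le
    rw [div_le_one (by positivity)]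
    refine le_of_mul_le_mul_left ?_ hc
    nlinarith
  obtain ⟨G, hdeg, hdens, hcyc⟩ := exists_sparse_uniform_graph (l := 2 * t)
    (D := 15 / 2 * K / ε) hb hε (by linarith) (by omega) hm
    (p := 30 * K / (ε ^ 2 * m ^ 2)) (by positivity) hp1 (by positivity)
    (by field_simp; norm_num)
    (sum_failure_lt_one ha hb hc hε hgood2 hm hK3 hKm (by linarith))
  exact ⟨G, hdeg, ⟨30 * K / (ε ^ 2 * m ^ 2), by positivity, hdens⟩, hcyc⟩
end
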